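/- arXiv:2508.02030 — 2 statements merged into one kernel-verified Lean document; each statement's English description precedes it below -/
import Mathlib

section
/- Let n ≥ 1, let π be a permutation of Fin n, and let the percolation closure C(π) be decomposed into m square all-ones tiles, where tile j (for j ∈ Fin m) occupies rows [r j, r j + s j) and columns [cs j, cs j + s j) with cs j = ∑_{i<j} s i, the row intervals partitioning {0,…,n−1}. Let ρ : Fin m → Fin m record the rank of each tile's rows, i.e., ρ j = #{i : r i < r j}. Then the condensed m × m permutation matrix with a 1 in position (ρ j, j) for each j is no-growth: for every j with j + 1 < m, |ρ(j+1) − ρ(j)| ≠ 1 (as integers). -/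
/-- Two cells of the `n × n` board are cardinal (north/south/east/west) neighbors. -/
def Adj {n : ℕ} (c d : Fin n × Fin n) : Prop :=
  (c.1 = d.1 ∧ ((c.2 : ℕ) + 1 = (d.2 : ℕ) ∨ (d.2 : ℕ) + 1 = (c.2 : ℕ))) ∨
  (c.2 = d.2 ∧ ((c.1 : ℕ) + 1 = (d.1 : ℕ) ∨ (d.1 : ℕ) + 1 = (c.1 : ℕ)))

/-- A cell `c` is mutable for a set `T` of cells: `c ∉ T` and at least two of its
cardinal neighbors belong to `T`. -/
def IsMutable {n : ℕ} (T : Set (Fin n × Fin n)) (c : Fin n × Fin n) : Prop :=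
  c ∉ T ∧ ∃ d ∈ T, ∃ e ∈ T, d ≠ e ∧ Adj c d ∧ Adj c e

/-- One percolation step: adjoin a single mutable cell. -/
def PercStep {n : ℕ} (T T' : Set (Fin n × Fin n)) : Prop :=
  ∃ c, IsMutable T c ∧ T' = T ∪ {c}

/-- The graph of a permutation `π`, i.e. the set of cells `(i, π i)`. -/
def graphOf {n : ℕ} (π : Equiv.Perm (Fin n)) : Set (Fin n × Fin n) :=
  {p | p.2 = π p.1}

/-- A set of cells is percolation-closed if it contains every cell having at least two
cardinal neighbors in the set. -/
def PercClosed {n : ℕ} (S : Set (Fin n × Fin n)) : Prop :=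
  ∀ c, (∃ d ∈ S, ∃ e ∈ S, d ≠ e ∧ Adj c d ∧ Adj c e) → c ∈ S

/-- The percolation closure of `π`: the smallest percolation-closed set containing the
graph of `π`. -/
def percClosure {n : ℕ} (π : Equiv.Perm (Fin n)) : Set (Fin n × Fin n) :=
  ⋂₀ {S | graphOf π ⊆ S ∧ PercClosed S}

/-- `π` is full if its percolation closure is the whole board. -/
def Full {n : ℕ} (π : Equiv.Perm (Fin n)) : Prop :=
  percClosure π = Set.univ

/-- A permutation of `Fin m` is indecomposable if it maps no proper initial segment
`{0, …, k−1}` (with `1 ≤ k < m`) onto itself. -/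
def Indecomposable {m : ℕ} (σ : Equiv.Perm (Fin m)) : Prop :=
  ¬ ∃ k, 1 ≤ k ∧ k < m ∧
    (fun i => σ i) '' {i : Fin m | (i : ℕ) < k} = {i : Fin m | (i : ℕ) < k}

/-- `π` is no-growth if no cell is mutable for its graph. -/
def NoGrowth {n : ℕ} (π : Equiv.Perm (Fin n)) : Prop :=
  ∀ c, ¬ IsMutable (graphOf π) c

theorem percClosure_closed {n : ℕ} (π : Equiv.Perm (Fin n)) : PercClosed (percClosure π) := by
  rintro c ⟨d, hd, e, he, hne, h1, h2⟩ S hS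
  exact hS.2 c ⟨d, hd S hS, e, he S hS, hne, h1, h2⟩

theorem tile_bound (n m : ℕ) (s r : Fin m → ℕ) (hsum : ∑ j, s j = n)
    (hpart : ∀ x : ℕ, x < n → ∃! j : Fin m, r j ≤ x ∧ x < r j + s j) (j : Fin m) :
    ∀ x, r j ≤ x → x < r j + s j → x < n := by
  classical
  have hsub : ∀ i, (Finset.range n).filter (fun x => r i ≤ x ∧ x < r i + s i)
      ⊆ Finset.Ico (r i) (r i + s i) := by
    intro i x hx
    simp at hx ⊢
    omega
  have hcard : ∑ i, ((Finset.range n).filter (fun x => r i ≤ x ∧ x < r i + s i)).card = n := by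
    simp_rw [Finset.card_filter]
    rw [Finset.sum_comm]
    have : ∀ x ∈ Finset.range n,
        (∑ i : Fin m, if r i ≤ x ∧ x < r i + s i then 1 else 0) = 1 := by
      intro x hx
      obtain ⟨i, hi, hu⟩ := hpart x (Finset.mem_range.1 hx)
      rw [← Finset.card_filter, Finset.card_eq_one]
      refine ⟨i, ?_⟩
      ext a
      simp only [Finset.mem_filter, Finset.mem_univ, true_and, Finset.mem_singleton]
      exact ⟨fun h => hu a h, fun h => h ▸ hi⟩
    rw [Finset.sum_congr rfl this]
    simp
  have hle : ∀ i ∈ Finset.univ,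
      ((Finset.range n).filter (fun x => r i ≤ x ∧ x < r i + s i)).card ≤ s i := by
    intro i _
    have := Finset.card_le_card (hsub i)
    simpa using this
  have heq := (Finset.sum_eq_sum_iff_of_le hle).1 (hcard.trans hsum.symm) j (Finset.mem_univ j)
  have hE := Finset.eq_of_subset_of_card_le (hsub j) (by simp [heq])
  intro x h1 h2
  have : x ∈ Finset.Ico (r j) (r j + s j) := by simp [h1, h2]
  rw [← hE] at this
  simp at this
  exact this.1

theorem tile_next (n m : ℕ) (s r : Fin m → ℕ) (hs : ∀ j, 0 < s j) (hsum : ∑ j, s j = n)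
    (hpart : ∀ x : ℕ, x < n → ∃! j : Fin m, r j ≤ x ∧ x < r j + s j) (j k : Fin m)
    (h : (Finset.univ.filter (fun i => r i < r k)).card =
      (Finset.univ.filter (fun i => r i < r j)).card + 1) : r k = r j + s j := by
  have hb := tile_bound n m s r hsum hpart
  have hlt : ∀ i, r i < n := fun i => hb i (r i) le_rfl (by have := hs i; omega)
  have hjk : r j < r k := by
    by_contra hc
    have : (Finset.univ.filter (fun i => r i < r k)).card ≤
      (Finset.univ.filter (fun i => r i < r j)).card := by
      apply Finset.card_le_card
      intro i hi
      simp at hi ⊢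
      omega
    omega
  have hge : r j + s j ≤ r k := by
    by_contra hc
    have := (hpart (r k) (hlt k)).unique (y₁ := j) (y₂ := k) ⟨by omega, by omega⟩
      ⟨le_rfl, by have := hs k; omega⟩
    subst this
    omega
  by_contra hne
  obtain ⟨i, ⟨hi1, hi2⟩, -⟩ := hpart (r j + s j) (by have := hlt k; omega)
  have hji : r j < r i := by
    by_contra hc
    have := (hpart (r j) (hlt j)).unique (y₁ := i) (y₂ := j) ⟨by omega, by omega⟩
      ⟨le_rfl, by have := hs j; omega⟩
    subst this
    omega
  have hsub : insert i (insert j (Finset.univ.filter (fun a => r a < r j))) ⊆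
      Finset.univ.filter (fun a => r a < r k) := by
    intro a ha
    simp only [Finset.mem_insert, Finset.mem_filter, Finset.mem_univ, true_and] at ha ⊢
    rcases ha with rfl | rfl | ha <;> omega
  have := Finset.card_le_card hsub
  have hij : i ≠ j := by rintro rfl; omega
  rw [Finset.card_insert_of_notMem (by simp [hij]; omega),
    Finset.card_insert_of_notMem (by simp)] at this
  omega

theorem stmt_4 (n : ℕ) (hn : 1 ≤ n) (π : Equiv.Perm (Fin n))
    (m : ℕ) (hm : 1 ≤ m) (hmn : m ≤ n) (s r : Fin m → ℕ)
    (hs : ∀ j, 0 < s j) (hsum : ∑ j, s j = n)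
    (hpart : ∀ x : ℕ, x < n → ∃! j : Fin m, r j ≤ x ∧ x < r j + s j)
    (hclosure : percClosure π = {p : Fin n × Fin n | ∃ j : Fin m,
        r j ≤ (p.1 : ℕ) ∧ (p.1 : ℕ) < r j + s j ∧
        (∑ i ∈ Finset.univ.filter (fun i => i < j), s i) ≤ (p.2 : ℕ) ∧
        (p.2 : ℕ) < (∑ i ∈ Finset.univ.filter (fun i => i < j), s i) + s j})
    (ρ : Fin m → ℕ)
    (hρ : ∀ j, ρ j = (Finset.univ.filter (fun i => r i < r j)).card) :
    ∀ j k : Fin m, (j : ℕ) + 1 = (k : ℕ) →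
      (ρ k : ℤ) - (ρ j : ℤ) ≠ 1 ∧ (ρ k : ℤ) - (ρ j : ℤ) ≠ -1 := by 
  intro j k hjk
  have hb := tile_bound n m s r hsum hpart
  have hcl := percClosure_closed π
  rw [hclosure] at hcl
  have hcs : (∑ i ∈ Finset.univ.filter (fun i => i < k), s i) =
      (∑ i ∈ Finset.univ.filter (fun i => i < j), s i) + s j := by
    have : Finset.univ.filter (fun i => i < k) =
        insert j (Finset.univ.filter (fun i => i < j)) := by
      ext a
      simp only [Finset.mem_insert, Finset.mem_filter, Finset.mem_univ, true_and,
        Fin.lt_def, Fin.ext_iff]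
      omega
    rw [this, Finset.sum_insert (by simp), add_comm]
  have hcn : (∑ i ∈ Finset.univ.filter (fun i => i < k), s i) + s k ≤ n := by
    rw [add_comm, ← Finset.sum_insert (f := s) (a := k) (by simp), ← hsum]
    exact Finset.sum_le_sum_of_subset (Finset.subset_univ _)
  have hsj := hs j
  have hsk := hs k
  have hrj := hb j (r j + s j - 1) (by omega) (by omega)
  have hrk := hb k (r k + s k - 1) (by omega) (by omega)
  constructor
  · intro h
    have hr := tile_next n m s r hs hsum hpart j k (by rw [← hρ, ← hρ]; omega)
    obtain ⟨i, h1, h2, h3, h4⟩ := hcl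
      (⟨r k - 1, by omega⟩, ⟨∑ i ∈ Finset.univ.filter (fun i => i < k), s i, by omega⟩)
      ⟨(⟨r k - 1, by omega⟩, ⟨(∑ i ∈ Finset.univ.filter (fun i => i < k), s i) - 1, by omega⟩),
        ⟨j, by dsimp only; omega⟩,
        (⟨r k, by omega⟩, ⟨∑ i ∈ Finset.univ.filter (fun i => i < k), s i, by omega⟩),
        ⟨k, by dsimp only; omega⟩,
        by simp [Fin.ext_iff]; omega,
        by left; refine ⟨rfl, ?_⟩; dsimp only; omega,
        by right; refine ⟨rfl, ?_⟩; dsimp only; omega⟩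
    dsimp only at h1 h2 h3 h4
    have := (hpart (r k - 1) (by omega)).unique (y₁ := i) (y₂ := j) ⟨h1, h2⟩
      ⟨by omega, by omega⟩
    subst this
    omega
  · intro h
    have hr := tile_next n m s r hs hsum hpart k j (by rw [← hρ, ← hρ]; omega)
    obtain ⟨i, h1, h2, h3, h4⟩ := hcl
      (⟨r j - 1, by omega⟩, ⟨(∑ i ∈ Finset.univ.filter (fun i => i < k), s i) - 1, by omega⟩)
      ⟨(⟨r j - 1, by omega⟩, ⟨(∑ i ∈ Finset.univ.filter (fun i => i < k), s i), by omega⟩),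
        ⟨k, by dsimp only; omega⟩,
        (⟨r j, by omega⟩, ⟨(∑ i ∈ Finset.univ.filter (fun i => i < k), s i) - 1, by omega⟩),
        ⟨j, by dsimp only; omega⟩,
        by simp [Fin.ext_iff]; omega,
        by left; refine ⟨rfl, ?_⟩; dsimp only; omega,
        by right; refine ⟨rfl, ?_⟩; dsimp only; omega⟩
    dsimp only at h1 h2 h3 h4
    have := (hpart (r j - 1) (by omega)).unique (y₁ := i) (y₂ := k) ⟨h1, h2⟩
      ⟨by omega, by omega⟩
    subst this
    omega
end

section
/- (Half-lemma) For every n ≥ 2, twice the number of full indecomposable permutations of Fin n equals the number of full permutations of Fin n; equivalently, exactly half of the full permutations of Fin n are indecomposable and half are decomposable. -/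
lemma full_iff {n : ℕ} (π : Equiv.Perm (Fin n)) :
    Full π ↔ ∀ S : Set (Fin n × Fin n), graphOf π ⊆ S → PercClosed S → S = Set.univ := by
  unfold Full percClosure
  rw [Set.sInter_eq_univ]
  constructor
  · intro h S h1 h2
    exact h S ⟨h1, h2⟩
  · intro h S hS
    exact h S hS.1 hS.2

/-- The vertical reflection of a permutation. -/
def rv {n : ℕ} (π : Equiv.Perm (Fin n)) : Equiv.Perm (Fin n) := π.trans Fin.revPerm

lemma rv_apply {n : ℕ} (π : Equiv.Perm (Fin n)) (i : Fin n) : rv π i = (π i).rev := rfl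

lemma rv_rv {n : ℕ} (π : Equiv.Perm (Fin n)) : rv (rv π) = π := by
  ext i; simp [rv_apply]

lemma adj_rev {n : ℕ} {c d : Fin n × Fin n} (h : Adj c d) :
    Adj (c.1, c.2.rev) (d.1, d.2.rev) := by
  unfold Adj at *
  have h1 := c.2.isLt
  have h2 := d.2.isLt
  simp only [Fin.val_rev, Fin.rev_inj]
  rcases h with ⟨h, h'⟩ | h
  · left
    refine ⟨h, ?_⟩
    omega
  · exact Or.inr h

lemma full_rv {n : ℕ} {π : Equiv.Perm (Fin n)} (h : Full π) : Full (rv π) := by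
  rw [full_iff] at *
  intro S hg hc
  have := h {p | (p.1, p.2.rev) ∈ S} ?_ ?_
  · ext ⟨i, j⟩
    have h2 : (i, j.rev) ∈ {p : Fin n × Fin n | (p.1, p.2.rev) ∈ S} := by rw [this]; trivial
    simpa using h2
  · intro p hp
    apply hg
    simp only [graphOf, Set.mem_ofPred_eq] at hp ⊢
    rw [rv_apply, hp]
  · rintro c ⟨d, hd, e, he, hne, h1, h2⟩
    refine hc _ ⟨_, hd, _, he, ?_, adj_rev h1, adj_rev h2⟩
    intro heq
    apply hne
    simp only [Prod.mk.injEq, Fin.rev_inj] at heq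
    exact Prod.ext heq.1 heq.2

/-- `π` maps the interval `[a,b]` onto the interval `[c,d]`. -/
def Blk {n : ℕ} (π : Equiv.Perm (Fin n)) (a b c d : ℕ) : Prop :=
  a ≤ b ∧ b < n ∧ c ≤ d ∧ d < n ∧
    ∀ i : Fin n, (a ≤ (i : ℕ) ∧ (i : ℕ) ≤ b) ↔ (c ≤ (π i : ℕ) ∧ (π i : ℕ) ≤ d)

lemma corner {n : ℕ} {π : Equiv.Perm (Fin n)} {b d : ℕ} (h : Blk π 0 b 0 d) (hb : b + 1 < n) :
    ¬ Indecomposable π := by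
  obtain ⟨-, h1, -, h2, h3⟩ := h
  unfold Indecomposable
  rw [not_not]
  have himg : (Finset.Iic (⟨b, h1⟩ : Fin n)).map π.toEmbedding = Finset.Iic ⟨d, h2⟩ := by
    ext j
    simp only [Finset.mem_map_equiv, Finset.mem_Iic, Fin.le_def]
    have := h3 (π.symm j)
    simpa using this
  have hcard := congrArg Finset.card himg
  simp only [Finset.card_map, Fin.card_Iic] at hcard
  refine ⟨b + 1, by omega, hb, ?_⟩
  ext j
  simp only [Set.mem_image, Set.mem_ofPred_eq]
  constructor
  · rintro ⟨i, hi, rfl⟩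
    have := (h3 i).1 (by omega)
    omega
  · intro hj
    refine ⟨π.symm j, ?_, by simp⟩
    have := (h3 (π.symm j)).2 (by simp; omega)
    omega

lemma corner' {n : ℕ} {π : Equiv.Perm (Fin n)} {b c d : ℕ} (h : Blk π 0 b c d) (hb : b + 1 < n)
    (hd : d + 1 = n) : ¬ Indecomposable (rv π) := by
  refine corner (b := b) (d := n - 1 - c) ?_ hb
  obtain ⟨h0, h1, h4, h2, h3⟩ := h
  refine ⟨h0, h1, by omega, by omega, fun i => ?_⟩
  rw [h3 i, rv_apply, Fin.val_rev]
  have := (π i).isLt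
  omega

lemma full_iff_dom {n : ℕ} {π : Equiv.Perm (Fin n)} {a b c d : ℕ} (h : Blk π a b c d) :
    (a = 0 ∧ b + 1 = n) ↔ (c = 0 ∧ d + 1 = n) := by
  obtain ⟨h0, h1, h4, h2, h3⟩ := h
  constructor
  · rintro ⟨rfl, hb⟩
    have e1 := (h3 (π.symm ⟨0, by omega⟩)).1 (by have := (π.symm ⟨0, by omega⟩).isLt; omega)
    have e2 := (h3 (π.symm ⟨n-1, by omega⟩)).1 (by have := (π.symm ⟨n-1, by omega⟩).isLt; omega)
    simp at e1 e2
    omega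
  · rintro ⟨rfl, hb⟩
    have e1 := (h3 ⟨0, by omega⟩).2 (by have := (π ⟨0, by omega⟩).isLt; omega)
    have e2 := (h3 ⟨n-1, by omega⟩).2 (by have := (π ⟨n-1, by omega⟩).isLt; omega)
    simp at e1 e2
    omega

lemma union_blk {n : ℕ} {π : Equiv.Perm (Fin n)} {a b c d a' b' c' d' : ℕ}
    (h : Blk π a b c d) (h' : Blk π a' b' c' d')
    (hI : max a a' ≤ min b b' + 1) (hJ : max c c' ≤ min d d' + 1) :
    Blk π (min a a') (max b b') (min c c') (max d d') := by
  obtain ⟨h0, h1, h4, h2, h3⟩ := h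
  obtain ⟨h0', h1', h4', h2', h3'⟩ := h'
  refine ⟨by omega, by omega, by omega, by omega, fun i => ?_⟩
  have e := h3 i
  have e' := h3' i
  omega

lemma meet {n : ℕ} {π : Equiv.Perm (Fin n)} {a b c d a' b' c' d' : ℕ}
    (h : Blk π a b c d) (h' : Blk π a' b' c' d') :
    max a a' ≤ min b b' ↔ max c c' ≤ min d d' := by
  obtain ⟨h0, h1, h4, h2, h3⟩ := h
  obtain ⟨h0', h1', h4', h2', h3'⟩ := h'
  constructor
  · intro hm
    have e := (h3 ⟨max a a', by omega⟩).1 (by simp only; omega)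
    have e' := (h3' ⟨max a a', by omega⟩).1 (by simp only; omega)
    omega
  · intro hm
    have e := (h3 (π.symm ⟨max c c', by omega⟩)).2 (by simp only [Equiv.apply_symm_apply]; omega)
    have e' := (h3' (π.symm ⟨max c c', by omega⟩)).2 (by simp only [Equiv.apply_symm_apply]; omega)
    omega

lemma decomp_of_full {n : ℕ} (hn : 2 ≤ n) {π : Equiv.Perm (Fin n)} (h : Full π) :
    ¬ Indecomposable π ∨ ¬ Indecomposable (rv π) := by
  by_contra hcon
  rw [full_iff] at h
  have key := h {p | ∃ a b c d, Blk π a b c d ∧ ¬ (a = 0 ∧ b + 1 = n) ∧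
      a ≤ (p.1 : ℕ) ∧ (p.1 : ℕ) ≤ b ∧ c ≤ (p.2 : ℕ) ∧ (p.2 : ℕ) ≤ d} ?_ ?_
  · have h0 : ((⟨0, by omega⟩, ⟨0, by omega⟩) : Fin n × Fin n) ∈ (Set.univ : Set (Fin n × Fin n)) :=
      trivial
    rw [← key] at h0
    obtain ⟨a, b, c, d, hB, hp, h1, h2, h3, h4⟩ := h0
    simp only [Nat.le_zero] at h1 h3
    subst h1 h3
    have := hB.2.1
    exact hcon (Or.inl (corner hB (by omega)))
  · rintro ⟨i, j⟩ hp
    simp only [graphOf, Set.mem_ofPred_eq] at hp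
    subst hp
    refine ⟨i, i, π i, π i, ⟨le_rfl, i.isLt, le_rfl, (π i).isLt, fun k => ?_⟩, by omega,
      le_rfl, le_rfl, le_rfl, le_rfl⟩
    have e1 : ((i : ℕ) ≤ k ∧ (k : ℕ) ≤ i) ↔ k = i := by rw [Fin.ext_iff]; omega
    have e2 : ((π i : ℕ) ≤ π k ∧ (π k : ℕ) ≤ π i) ↔ π k = π i := by rw [Fin.ext_iff]; omega
    rw [e1, e2, π.injective.eq_iff]
  · rintro ⟨x, y⟩ ⟨⟨x1, y1⟩, ⟨a, b, c, d, hB, hp, h1, h2, h3, h4⟩, ⟨x2, y2⟩,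
      ⟨a', b', c', d', hB', hp', h1', h2', h3', h4'⟩, hne, ad1, ad2⟩
    simp only [Adj, Fin.ext_iff, ne_eq, Prod.mk.injEq] at *
    have hm := meet hB hB'
    have hI : max a a' ≤ min b b' + 1 := by omega
    have hJ : max c c' ≤ min d d' + 1 := by omega
    have hU := union_blk hB hB' hI hJ
    refine ⟨_, _, _, _, hU, ?_, by dsimp only; omega, by dsimp only; omega, by dsimp only; omega,
      by dsimp only; omega⟩
    intro hw
    have hw2 := (full_iff_dom hU).1 hw
    have f1 := full_iff_dom hB
    have f2 := full_iff_dom hB'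
    obtain ⟨g0, g1, g4, g2, -⟩ := id hB
    obtain ⟨g0', g1', g4', g2', -⟩ := id hB'
    apply hcon
    have cases4 : (a = 0 ∧ c = 0) ∨ (a = 0 ∧ d + 1 = n) ∨ (a' = 0 ∧ c' = 0) ∨
        (a' = 0 ∧ d' + 1 = n) := by omega
    rcases cases4 with ⟨rfl, rfl⟩ | ⟨rfl, e⟩ | ⟨rfl, rfl⟩ | ⟨rfl, e⟩
    · exact Or.inl (corner hB (by omega))
    · exact Or.inr (corner' hB (by omega) e)
    · exact Or.inl (corner hB' (by omega))
    · exact Or.inr (corner' hB' (by omega) e)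

lemma not_both {n : ℕ} {π : Equiv.Perm (Fin n)} (h : ¬ Indecomposable π) :
    Indecomposable (rv π) := by
  rintro ⟨k', hk', hkn', e'⟩
  apply h
  rintro ⟨k, hk, hkn, e⟩
  have q1 : ∀ i : Fin n, (i : ℕ) < k ↔ (π i : ℕ) < k := by
    intro i
    have := Set.ext_iff.1 e (π i)
    simpa using this
  have q2 : ∀ i : Fin n, (i : ℕ) < k' ↔ (rv π i : ℕ) < k' := by
    intro i
    have := Set.ext_iff.1 e' (rv π i)
    simpa using this
  have a1 := q1 (π.symm ⟨0, by omega⟩)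
  have a2 := q2 (π.symm ⟨0, by omega⟩)
  have b1 := q1 (π.symm ⟨n - 1, by omega⟩)
  have b2 := q2 (π.symm ⟨n - 1, by omega⟩)
  simp only [rv_apply, Equiv.apply_symm_apply, Fin.val_rev] at a1 a2 b1 b2
  omega

theorem stmt_9 (n : ℕ) (hn : 2 ≤ n) :
    2 * Nat.card {π : Equiv.Perm (Fin n) // Full π ∧ Indecomposable π}
      = Nat.card {π : Equiv.Perm (Fin n) // Full π} := by
  classical
  have e1 : {π : Equiv.Perm (Fin n) // Full π ∧ Indecomposable π} ≃
      {π : Equiv.Perm (Fin n) // Full π ∧ ¬ Indecomposable π} :=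
    { toFun := fun p => ⟨rv p.1, full_rv p.2.1, by
        rcases decomp_of_full hn p.2.1 with h | h
        · exact absurd p.2.2 h
        · exact h⟩
      invFun := fun p => ⟨rv p.1, full_rv p.2.1, not_both p.2.2⟩
      left_inv := fun p => Subtype.ext (rv_rv p.1)
      right_inv := fun p => Subtype.ext (rv_rv p.1) }
  have e2 := Nat.card_congr e1
  have e3 : Nat.card {π : Equiv.Perm (Fin n) // Full π} =
      Nat.card {π : Equiv.Perm (Fin n) // Full π ∧ Indecomposable π} +
      Nat.card {π : Equiv.Perm (Fin n) // Full π ∧ ¬ Indecomposable π} := by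
    simp only [Nat.card_eq_fintype_card, Fintype.card_subtype]
    rw [← Finset.card_filter_add_card_filter_not (s := Finset.univ.filter Full)
      (fun π : Equiv.Perm (Fin n) => Indecomposable π), Finset.filter_filter, Finset.filter_filter]
  omega
end
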